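/- Let $n > 0$, $\Delta t_k > 0$, and let $\Phi(t)$ be the Hill-Clohessy-Wiltshire state transition matrix. Let $e_6 = (0,0,0,0,0,1)^T$. Then $\int_{0}^{\Delta t_k} \Phi(s)\,e_6\,e_6^T\,\Phi(s)^T\,ds$ equals the symmetric $6\times 6$ matrix that is zero everywhere except the entries $(3,3) = \frac{1}{n^2}\zeta_{ss}$, $(6,3) = (3,6) = \frac{1}{n}\zeta_{cs}$, and $(6,6) = \zeta_{cc}$. -/

import Mathlib

open MeasureTheory Matrix Real

theorem mul_vecMulVec_mul_transpose_apply {l m : Type*} [Fintype m] [DecidableEq m]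
    (A : Matrix l m ℝ) (k : m) (i j : l) :
    (A * vecMulVec (Pi.single k 1 : m → ℝ) (Pi.single k 1 : m → ℝ) * Aᵀ) i j
      = A i k * A j k := by
  rw [mul_vecMulVec, vecMulVec_mul, vecMul_transpose, mulVec_single_one, vecMulVec_apply]
  rfl

theorem integral_cos_mul_sq {n : ℝ} (hn : n ≠ 0) (T : ℝ) :
    ∫ s in (0 : ℝ)..T, cos (n * s) ^ 2 = T / 2 + 1 / (4 * n) * sin (2 * n * T) := by
  rw [intervalIntegral.integral_comp_mul_left (fun x => cos x ^ 2) hn, integral_cos_sq,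
    mul_assoc 2 n T, sin_two_mul, smul_eq_mul]
  simp only [mul_zero, sin_zero]
  field_simp
  ring

theorem integral_sin_mul_sq {n : ℝ} (hn : n ≠ 0) (T : ℝ) :
    ∫ s in (0 : ℝ)..T, sin (n * s) ^ 2 = T / 2 - 1 / (4 * n) * sin (2 * n * T) := by
  rw [intervalIntegral.integral_comp_mul_left (fun x => sin x ^ 2) hn, integral_sin_sq,
    mul_assoc 2 n T, sin_two_mul, smul_eq_mul]
  simp only [mul_zero, sin_zero]
  field_simp
  ring

theorem integral_sin_mul_mul_cos_mul {n : ℝ} (hn : n ≠ 0) (T : ℝ) :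
    ∫ s in (0 : ℝ)..T, sin (n * s) * cos (n * s) = 1 / (4 * n) * (1 - cos (2 * n * T)) := by
  rw [intervalIntegral.integral_comp_mul_left (fun x => sin x * cos x) hn,
    integral_sin_mul_cos₁, mul_assoc 2 n T, cos_two_mul, cos_sq', smul_eq_mul]
  simp only [mul_zero, sin_zero]
  field_simp
  ring

theorem hcw_process_noise_covariance_normal
    (n Δt : ℝ) (hn : 0 < n) (hΔt : 0 < Δt)
    (Φ : ℝ → Matrix (Fin 6) (Fin 6) ℝ)
    (hΦ : ∀ t, Φ t =
      !![4 - 3 * cos (n * t), 0, 0, (1 / n) * sin (n * t),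
           (2 / n) * (1 - cos (n * t)), 0;
         6 * (sin (n * t) - n * t), 1, 0, (2 / n) * (cos (n * t) - 1),
           (1 / n) * (4 * sin (n * t) - 3 * n * t), 0;
         0, 0, cos (n * t), 0, 0, (1 / n) * sin (n * t);
         3 * n * sin (n * t), 0, 0, cos (n * t), 2 * sin (n * t), 0;
         6 * n * (cos (n * t) - 1), 0, 0, -2 * sin (n * t), 4 * cos (n * t) - 3, 0;
         0, 0, -n * sin (n * t), 0, 0, cos (n * t)])
    (ζcc ζss ζcs : ℝ)
    (hζcc : ζcc = Δt / 2 + (1 / (4 * n)) * sin (2 * n * Δt))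
    (hζss : ζss = Δt / 2 - (1 / (4 * n)) * sin (2 * n * Δt))
    (hζcs : ζcs = (1 / (4 * n)) * (1 - cos (2 * n * Δt))) :
    (Matrix.of fun i j => ∫ s in (0:ℝ)..Δt,
        (Φ s * Matrix.vecMulVec (![0, 0, 0, 0, 0, 1] : Fin 6 → ℝ)
          (![0, 0, 0, 0, 0, 1] : Fin 6 → ℝ) * (Φ s)ᵀ) i j)
      = !![0, 0, 0, 0, 0, 0;
           0, 0, 0, 0, 0, 0;
           0, 0, (1 / n ^ 2) * ζss, 0, 0, (1 / n) * ζcs;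
           0, 0, 0, 0, 0, 0;
           0, 0, 0, 0, 0, 0;
           0, 0, (1 / n) * ζcs, 0, 0, ζcc] := by
  have he : (![0, 0, 0, 0, 0, 1] : Fin 6 → ℝ) = Pi.single 5 1 := by
    ext i; fin_cases i <;> simp
  have hcc : ∫ s in (0 : ℝ)..Δt, cos (n * s) * cos (n * s) = ζcc := by
    simp_rw [← sq, hζcc]
    exact integral_cos_mul_sq hn.ne' Δt
  have hss : ∫ s in (0 : ℝ)..Δt, 1 / n * sin (n * s) * (1 / n * sin (n * s))
      = 1 / n ^ 2 * ζss := by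
    rw [hζss, ← integral_sin_mul_sq hn.ne', ← intervalIntegral.integral_const_mul]
    congr 1; ext s; ring
  have hsc : ∫ s in (0 : ℝ)..Δt, 1 / n * sin (n * s) * cos (n * s) = 1 / n * ζcs := by
    rw [hζcs, ← integral_sin_mul_mul_cos_mul hn.ne', ← intervalIntegral.integral_const_mul]
    congr 1; ext s; ring
  have hcs : ∫ s in (0 : ℝ)..Δt, cos (n * s) * (1 / n * sin (n * s)) = 1 / n * ζcs := by
    rw [← hsc]
    congr 1; ext s; ring
  have hcol (s : ℝ) (i : Fin 6) :
      Φ s i 5 = ![0, 0, 1 / n * sin (n * s), 0, 0, cos (n * s)] i := by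
    rw [hΦ]; fin_cases i <;> rfl
  ext i j
  simp only [of_apply, he, mul_vecMulVec_mul_transpose_apply, hcol]
  fin_cases i <;> fin_cases j <;>
    first
    | exact hcc
    | exact hss
    | exact hsc
    | exact hcs
    | simp
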